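/- arXiv:2105.02913 — 2 statements merged into one kernel-verified Lean document; each statement's English description precedes it below -/
import Mathlib

section
/- Let Θ, Σ, φ, Ω, ξ, ρ, p, Π, Q be real numbers satisfying: (i) ξ·φ = Ω·(2Θ/3 − Σ); (ii) Q·(Ω² + ξ²) = −Ω·ξ·(ρ + p + Π); (iii) 2Θ/3 − Σ + φ = 0; (iv) Ω and ξ are not both zero; and (v) if Ω + ξ = 0 then 2(ξ² + 2ξΩ − Ω²) − (ρ + p + Π) + 2Q = 0. Then φ = 0 and 2Θ/3 − Σ = 0. -/
theorem lrs_mtt_minimal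
    (Θ Sg φ Ω ξ ρ p Pi0 Q : ℝ)
    (h1 : ξ * φ = Ω * (2 * Θ / 3 - Sg))
    (h2 : Q * (Ω ^ 2 + ξ ^ 2) = -(Ω * ξ * (ρ + p + Pi0)))
    (h3 : 2 * Θ / 3 - Sg + φ = 0)
    (h4 : ¬ (Ω = 0 ∧ ξ = 0))
    (h5 : Ω + ξ = 0 →
      2 * (ξ ^ 2 + 2 * ξ * Ω - Ω ^ 2) - (ρ + p + Pi0) + 2 * Q = 0) :
    φ = 0 ∧ 2 * Θ / 3 - Sg = 0 := by
  have hsum : Ω + ξ ≠ 0 := by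
    intro h
    have hΩ : Ω = -ξ := by linarith
    have hξ : ξ ≠ 0 := fun h0 => h4 ⟨by simp [hΩ, h0], h0⟩
    have hQ : 2 * Q = ρ + p + Pi0 := by
      apply mul_left_cancel₀ (pow_ne_zero 2 hξ)
      rw [hΩ] at h2
      linear_combination h2
    have h6 := h5 h
    rw [hΩ] at h6
    exact pow_ne_zero 2 hξ (by linear_combination (-1 / 4) * h6 + (1 / 4) * hQ)
  have hφ : φ = 0 := by
    apply mul_left_cancel₀ hsum
    linear_combination h1 + Ω * h3
  exact ⟨hφ, by linarith⟩
end

section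
/- Let Ω, ξ, ρ, p, Π, Q be real numbers with Ω = −ξ, Q·(Ω² + ξ²) = −Ω·ξ·(ρ + p + Π), and 2(ξ² + 2ξΩ − Ω²) − (ρ + p + Π) + 2Q = 0. Then ξ = 0 and Ω = 0. -/
theorem lrs_null_tube_contradiction
    (Ω ξ ρ p Pi0 Q : ℝ)
    (hΩ : Ω = -ξ)
    (hQ : Q * (Ω ^ 2 + ξ ^ 2) = -(Ω * ξ * (ρ + p + Pi0)))
    (hC : 2 * (ξ ^ 2 + 2 * ξ * Ω - Ω ^ 2) - (ρ + p + Pi0) + 2 * Q = 0) :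
    ξ = 0 ∧ Ω = 0 := by
  subst hΩ
  have hξ : ξ ^ 4 = 0 := by linear_combination (1 / 4) * hQ - (ξ ^ 2 / 4) * hC
  have hξ_zero : ξ = 0 := pow_eq_zero_iff (by norm_num) |>.mp hξ
  simp [hξ_zero]
end
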